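/- For every d ≥ 2, the set of canonical vertices of the White Whale H_∞^+(d,1) that are sums of exactly 2 generators is {(0,…,0,1,2)}: if S ⊆ G_d with |S| = 2, p(S) is a vertex of H_∞^+(d,1), and the coordinates of p(S) are nondecreasing, then p(S) is the point whose first d−2 coordinates are 0, whose (d−1)-st coordinate is 1 and whose last coordinate is 2; moreover this point is a vertex of H_∞^+(d,1), attained with S = {(0,…,0,1), (0,…,0,1,1)}. -/

import Mathlib

/-- The set `G_d` of generators of the White Whale:
all nonzero 0/1-valued vectors of `ℝ^d`. -/
def whaleGens (d : ℕ) : Set (Fin d → ℝ) :=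
  {g | g ≠ 0 ∧ ∀ i, g i = 0 ∨ g i = 1}

/-- The point `p(S)`: the sum of the vectors in `S` (with `p(∅) = 0`). -/
noncomputable def whaleSum {d : ℕ} (S : Set (Fin d → ℝ)) : Fin d → ℝ :=
  ∑ᶠ g ∈ S, g

/-- The White Whale `H_∞^+(d,1)`: the convex hull of the points `p(S)`
over all subsets `S ⊆ G_d`. -/
noncomputable def whiteWhale (d : ℕ) : Set (Fin d → ℝ) :=
  convexHull ℝ {x | ∃ S : Set (Fin d → ℝ), S ⊆ whaleGens d ∧ x = whaleSum S}

/-- A vertex of the White Whale is an extreme point of it. -/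
def IsWhaleVertex (d : ℕ) (x : Fin d → ℝ) : Prop :=
  x ∈ Set.extremePoints ℝ (whiteWhale d)

theorem whaleGens_finite (d : ℕ) : (whaleGens d).Finite := by
  refine (Set.Finite.pi' (fun _ : Fin d => Set.toFinite ({0, 1} : Set ℝ))).subset ?_
  rintro g ⟨-, hg⟩ i
  simpa using hg i

theorem whaleSum_mem_whiteWhale {d : ℕ} {S : Set (Fin d → ℝ)} (hS : S ⊆ whaleGens d) :
    whaleSum S ∈ whiteWhale d :=
  subset_convexHull ℝ _ ⟨S, hS, rfl⟩

theorem whaleSum_pair {d : ℕ} {g h : Fin d → ℝ} (hgh : g ≠ h) : whaleSum {g, h} = g + h :=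
  finsum_mem_pair hgh

theorem whaleSum_eq_sum {d : ℕ} (F : Finset (Fin d → ℝ)) :
    whaleSum (F : Set (Fin d → ℝ)) = ∑ g ∈ F, g :=
  finsum_mem_coe_finset _ _

theorem nonneg_of_mem_whaleGens {d : ℕ} {g : Fin d → ℝ} (hg : g ∈ whaleGens d) : 0 ≤ g := by
  intro i
  rcases hg.2 i with h | h <;> simp [h]

theorem eq_empty_of_whaleSum_eq_zero {d : ℕ} {S : Set (Fin d → ℝ)} (hS : S ⊆ whaleGens d)
    (h : whaleSum S = 0) : S = ∅ := by
  obtain ⟨F, rfl⟩ := ((whaleGens_finite d).subset hS).exists_finset_coe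
  rw [whaleSum_eq_sum] at h
  refine Set.eq_empty_of_forall_notMem fun g hg => ?_
  have hle : g ≤ ∑ g ∈ F, g :=
    Finset.single_le_sum (f := fun g : Fin d → ℝ => g)
      (fun x hx => nonneg_of_mem_whaleGens (hS hx)) hg
  exact (hS hg).1 (le_antisymm (h ▸ hle) (nonneg_of_mem_whaleGens (hS hg)))

/-- The set of generators summing to a vertex contains every other set of generators with the
same sum. -/
theorem IsWhaleVertex.subset_of_whaleSum_eq {d : ℕ} {S T : Set (Fin d → ℝ)}
    (hv : IsWhaleVertex d (whaleSum S)) (hS : S ⊆ whaleGens d) (hT : T ⊆ whaleGens d)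
    (h : whaleSum T = whaleSum S) : T ⊆ S := by
  have hSf := (whaleGens_finite d).subset hS
  have hTf := (whaleGens_finite d).subset hT
  have hadd : whaleSum (S ∪ T) + whaleSum (S ∩ T) = whaleSum S + whaleSum T :=
    finsum_mem_union_inter hSf hTf
  have hunion : whaleSum (S ∪ T) = whaleSum S := by
    refine (mem_extremePoints.1 hv).2 _ (whaleSum_mem_whiteWhale (Set.union_subset hS hT)) _
      (whaleSum_mem_whiteWhale ((Set.inter_subset_left (t := T)).trans hS)) ?_ |>.1
    refine ⟨1 / 2, 1 / 2, by norm_num, by norm_num, by norm_num, ?_⟩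
    rw [← smul_add, hadd, h, ← two_smul ℝ, smul_smul]
    norm_num
  have hdiff : whaleSum (S ∪ T) = whaleSum S + whaleSum (T \ S) := by
    rw [← Set.union_sdiff_self]
    exact finsum_mem_union Set.disjoint_sdiff_right hSf (hTf.subset Set.sdiff_subset)
  rw [hunion, left_eq_add] at hdiff
  exact Set.sdiff_eq_empty.1
    (eq_empty_of_whaleSum_eq_zero (Set.sdiff_subset.trans hT) hdiff)

/-- The 0/1-valued vector with support `A`. -/
noncomputable def indVec {d : ℕ} (A : Set (Fin d)) : Fin d → ℝ := A.indicator 1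

theorem indVec_injective {d : ℕ} : Function.Injective (indVec (d := d)) :=
  fun _ _ h => Set.indicator_one_inj ℝ h

theorem indVec_union {d : ℕ} {A B : Set (Fin d)} (h : Disjoint A B) :
    indVec (A ∪ B) = indVec A + indVec B :=
  Set.indicator_union_of_disjoint h _

theorem indVec_union_add_inter {d : ℕ} (A B : Set (Fin d)) :
    indVec (A ∪ B) + indVec (A ∩ B) = indVec A + indVec B :=
  Set.indicator_union_add_inter _ _ _

theorem indVec_mem_whaleGens {d : ℕ} {A : Set (Fin d)} (hA : A.Nonempty) :
    indVec A ∈ whaleGens d := by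
  refine ⟨fun h => ?_, fun i => Set.indicator_eq_zero_or_self A 1 i⟩
  obtain ⟨a, ha⟩ := hA
  simpa [indVec, ha] using congrFun h a

theorem exists_indVec_eq {d : ℕ} {g : Fin d → ℝ} (hg : g ∈ whaleGens d) :
    ∃ A : Set (Fin d), A.Nonempty ∧ indVec A = g := by
  refine ⟨{i | g i = 1}, ?_, ?_⟩
  · obtain ⟨i, hi⟩ := Function.ne_iff.1 hg.1
    exact ⟨i, (hg.2 i).resolve_left hi⟩
  · ext i
    rcases hg.2 i with h | h <;> simp [indVec, h]

theorem whaleSum_indVec_pair {d : ℕ} {A B : Set (Fin d)} (h : A ≠ B) :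
    whaleSum {indVec A, indVec B} = indVec A + indVec B :=
  whaleSum_pair (indVec_injective.ne h)

/-- A nonempty set that is not a singleton splits into two nonempty pieces. -/
theorem exists_disjoint_union_eq {α : Type*} {A : Set α} (hA : A.Nonempty)
    (h : ∀ a, A ≠ {a}) :
    ∃ B C : Set α, B.Nonempty ∧ C.Nonempty ∧ Disjoint B C ∧ B ∪ C = A := by
  obtain ⟨a, ha⟩ := hA
  have hsub : {a} ⊆ A := Set.singleton_subset_iff.2 ha
  refine ⟨{a}, A \ {a}, Set.singleton_nonempty a, ?_, Set.disjoint_sdiff_right,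
    Set.union_sdiff_cancel hsub⟩
  rw [Set.sdiff_nonempty]
  exact fun h' => h a (h'.antisymm hsub)

theorem IsWhaleVertex.comparable {d : ℕ} {A B : Set (Fin d)} (hA : A.Nonempty)
    (hB : B.Nonempty) (hv : IsWhaleVertex d (whaleSum {indVec A, indVec B})) :
    A ⊆ B ∨ B ⊆ A := by
  by_contra! hcon
  obtain ⟨hAB, hBA⟩ := hcon
  have hne : A ≠ B := fun h => hAB h.le
  have hS : ({indVec A, indVec B} : Set (Fin d → ℝ)) ⊆ whaleGens d :=
    Set.pair_subset (indVec_mem_whaleGens hA) (indVec_mem_whaleGens hB)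
  have hU : indVec (A ∪ B) ∈ whaleGens d := indVec_mem_whaleGens hA.inl
  suffices h : indVec (A ∪ B) ∈ ({indVec A, indVec B} : Set (Fin d → ℝ)) by
    rcases h with h | h
    · exact hBA (Set.union_eq_left.1 (indVec_injective h))
    · exact hAB (Set.union_eq_right.1 (indVec_injective h))
  rcases (A ∩ B).eq_empty_or_nonempty with hI | hI
  · refine hv.subset_of_whaleSum_eq hS (Set.singleton_subset_iff.2 hU) ?_ rfl
    rw [whaleSum_indVec_pair hne, ← indVec_union (Set.disjoint_iff_inter_eq_empty.2 hI)]
    exact finsum_mem_singleton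
  · refine hv.subset_of_whaleSum_eq hS (T := {indVec (A ∪ B), indVec (A ∩ B)})
      (Set.pair_subset hU (indVec_mem_whaleGens hI)) ?_ (Or.inl rfl)
    rw [whaleSum_indVec_pair hne, whaleSum_indVec_pair, indVec_union_add_inter]
    exact fun h => hAB ((Set.subset_union_left.trans h.le).trans Set.inter_subset_right)

theorem IsWhaleVertex.exists_eq_singleton_pair {d : ℕ} {A B : Set (Fin d)} (hA : A.Nonempty)
    (hAB : A ⊂ B) (hv : IsWhaleVertex d (whaleSum {indVec A, indVec B})) :
    ∃ a b, a ≠ b ∧ A = {a} ∧ B = {a, b} := by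
  have hne : A ≠ B := hAB.ne
  have hS : ({indVec A, indVec B} : Set (Fin d → ℝ)) ⊆ whaleGens d :=
    Set.pair_subset (indVec_mem_whaleGens hA) (indVec_mem_whaleGens (hA.mono hAB.le))
  obtain ⟨a, rfl⟩ : ∃ a, A = {a} := by
    by_contra! hcon
    obtain ⟨P, Q, hP, hQ, hPQ, rfl⟩ := exists_disjoint_union_eq hA hcon
    have hPne : P ≠ P ∪ Q := fun h =>
      hQ.ne_empty (disjoint_self.1 (hPQ.mono_left (Set.union_eq_left.1 h.symm)))
    have hPB : P ≠ B := fun h => hAB.2 (h ▸ Set.subset_union_left)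
    have hQB : Q ≠ B := fun h => hAB.2 (h ▸ Set.subset_union_right)
    have hPQne : P ≠ Q := fun h => hQ.ne_empty (disjoint_self.1 (h ▸ hPQ))
    have hmem : indVec P ∈ ({indVec (P ∪ Q), indVec B} : Set (Fin d → ℝ)) := by
      refine hv.subset_of_whaleSum_eq hS (T := {indVec P, indVec Q, indVec B}) ?_ ?_ (Or.inl rfl)
      · exact Set.insert_subset (indVec_mem_whaleGens hP)
          (Set.pair_subset (indVec_mem_whaleGens hQ) (hS (Or.inr rfl)))
      · have hins : whaleSum {indVec P, indVec Q, indVec B} =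
            indVec P + whaleSum {indVec Q, indVec B} :=
          finsum_mem_insert _ (by simp [indVec_injective.eq_iff, hPQne, hPB]) (Set.toFinite _)
        rw [hins, whaleSum_indVec_pair hne, whaleSum_indVec_pair hQB, indVec_union hPQ, add_assoc]
    rcases hmem with h | h
    · exact hPne (indVec_injective h)
    · exact hPB (indVec_injective h)
  have haB : a ∈ B := hAB.le rfl
  have hC : (B \ {a}).Nonempty := Set.nonempty_of_ssubset hAB
  have hBC : {a} ∪ B \ {a} = B := Set.union_sdiff_cancel hAB.le
  obtain ⟨b, hb⟩ : ∃ b, B \ {a} = {b} := by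
    by_contra! hcon
    obtain ⟨P, Q, hP, hQ, hPQ, hU⟩ := exists_disjoint_union_eq hC hcon
    have haP : Disjoint {a} P :=
      Set.disjoint_sdiff_right.mono_right (hU ▸ Set.subset_union_left)
    have haQ : Disjoint {a} Q :=
      Set.disjoint_sdiff_right.mono_right (hU ▸ Set.subset_union_right)
    have hne' : {a} ∪ P ≠ {a} ∪ Q := by
      intro h
      obtain ⟨x, hx⟩ := hP
      have hxQ : x ∈ {a} ∪ Q := h ▸ Or.inr hx
      rcases hxQ with hxa | hxQ
      · exact Set.disjoint_left.1 haP hxa hx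
      · exact Set.disjoint_left.1 hPQ hx hxQ
    have hmem : indVec ({a} ∪ P) ∈ ({indVec {a}, indVec B} : Set (Fin d → ℝ)) := by
      refine hv.subset_of_whaleSum_eq hS (T := {indVec ({a} ∪ P), indVec ({a} ∪ Q)})
        (Set.pair_subset (indVec_mem_whaleGens hP.inr) (indVec_mem_whaleGens hQ.inr)) ?_
        (Or.inl rfl)
      rw [whaleSum_indVec_pair hne, whaleSum_indVec_pair hne', indVec_union haP, indVec_union haQ,
        ← hBC, indVec_union Set.disjoint_sdiff_right, ← hU, indVec_union hPQ]
      abel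
    rcases hmem with h | h
    · obtain ⟨x, hx⟩ := hP
      exact Set.disjoint_left.1 haP (Set.union_eq_left.1 (indVec_injective h) hx) hx
    · obtain ⟨x, hx⟩ := hQ
      have hxB : x ∈ B := hBC ▸ Or.inr (hU ▸ Or.inr hx)
      rw [← indVec_injective h] at hxB
      rcases hxB with hxa | hxP
      · exact Set.disjoint_left.1 haQ hxa hx
      · exact Set.disjoint_left.1 hPQ hxP hx
  refine ⟨a, b, ?_, rfl, ?_⟩
  · rintro rfl
    exact (hb.ge rfl).2 rfl
  · rw [← hBC, hb]
    rfl

theorem eq_of_monotone_indVec_add {d : ℕ} {a b : Fin d} (hab : a ≠ b)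
    (hm : Monotone (indVec {a} + indVec {a, b})) :
    indVec {a} + indVec {a, b} = fun i : Fin d =>
      if (i : ℕ) = d - 1 then 2 else if (i : ℕ) = d - 2 then 1 else 0 := by
  have hval : ∀ i, (indVec {a} + indVec {a, b}) i =
      if i = a then (2 : ℝ) else if i = b then 1 else 0 := by
    intro i
    by_cases h1 : i = a
    · simp [indVec, h1]; norm_num
    · by_cases h2 : i = b <;> simp [indVec, h1, h2, hab.symm]
  have hlt : ∀ i, i ≠ a → i < a := by
    intro i hi
    by_contra! hle
    have := hm hle
    rw [hval, hval, if_pos rfl, if_neg hi] at this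
    split_ifs at this <;> norm_num at this
  have hltb : ∀ i, i ≠ a → i ≠ b → i < b := by
    intro i hi hib
    by_contra! hle
    have := hm hle
    rw [hval, hval, if_neg hab.symm, if_pos rfl, if_neg hi, if_neg hib] at this
    norm_num at this
  have hba := hlt b hab.symm
  have ha : (a : ℕ) = d - 1 := by
    by_contra hne
    have := hlt ⟨d - 1, by omega⟩ (fun h => hne (by rw [← h]))
    rw [Fin.lt_def] at this
    simp only at this
    omega
  have hb : (b : ℕ) = d - 2 := by
    by_contra hne
    have := hltb ⟨d - 2, by omega⟩ (fun h => by
      have := congrArg Fin.val h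
      simp only at this
      omega) (fun h => hne (by rw [← h]))
    rw [Fin.lt_def] at this hba
    simp only at this
    omega
  ext i
  rw [hval, ← ha, ← hb]
  simp only [Fin.ext_iff]

/-- A linear functional that is nonpositive on all generators outside `{g, h}` and nonnegative
on `g` and `h` is maximized over the White Whale at `g + h`. -/
theorem le_add_of_mem_whiteWhale {d : ℕ} (f : (Fin d → ℝ) →ₗ[ℝ] ℝ) {g h : Fin d → ℝ}
    (hgh : g ≠ h) (hg : 0 ≤ f g) (hh : 0 ≤ f h)
    (hf : ∀ x ∈ whaleGens d, x ≠ g → x ≠ h → f x ≤ 0) {x : Fin d → ℝ}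
    (hx : x ∈ whiteWhale d) : f x ≤ f (g + h) := by
  classical
  refine convexHull_min (t := {y | f y ≤ f (g + h)}) ?_ (convex_halfSpace_le f.isLinear _) hx
  rintro _ ⟨S, hS, rfl⟩
  obtain ⟨F, rfl⟩ := ((whaleGens_finite d).subset hS).exists_finset_coe
  rw [Set.mem_ofPred_eq, whaleSum_eq_sum, map_sum, map_add, ← Finset.sum_pair hgh]
  calc ∑ y ∈ F, f y ≤ ∑ y ∈ F ∩ {g, h}, f y := by
        rw [← Finset.sum_inter_add_sum_sdiff F {g, h}]
        have : ∑ y ∈ F \ {g, h}, f y ≤ 0 := by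
          refine Finset.sum_nonpos fun y hy => ?_
          simp only [Finset.mem_sdiff, Finset.mem_insert, Finset.mem_singleton, not_or] at hy
          exact hf y (hS hy.1) hy.2.1 hy.2.2
        linarith
    _ ≤ ∑ y ∈ {g, h}, f y := by
        refine Finset.sum_le_sum_of_subset_of_nonneg Finset.inter_subset_right ?_
        intro y hy _
        rcases Finset.mem_insert.1 hy with rfl | hy
        · exact hg
        · rwa [Finset.mem_singleton.1 hy]

/-- A point of a set is extreme if it is determined by the linear functionals that it
maximizes over the set. -/
theorem mem_extremePoints_of_maximizers {E : Type*} [AddCommGroup E] [Module ℝ E] {A : Set E}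
    {p : E} (hp : p ∈ A)
    (h : ∀ x ∈ A, (∀ f : E →ₗ[ℝ] ℝ, (∀ y ∈ A, f y ≤ f p) → f x = f p) → x = p) :
    p ∈ A.extremePoints ℝ := by
  refine mem_extremePoints.2 ⟨hp, ?_⟩
  rintro x hx y hy ⟨s, t, hs, ht, hst, hxy⟩
  have key : ∀ f : E →ₗ[ℝ] ℝ, (∀ y ∈ A, f y ≤ f p) → f x = f p ∧ f y = f p := by
    intro f hf
    have hsum : s * f x + t * f y = f p := by simp [← hxy]
    have h1 := hf x hx
    have h2 := hf y hy
    have h3 : s * (f p - f x) + t * (f p - f y) = 0 := by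
      linear_combination f p * hst - hsum
    constructor <;> nlinarith [mul_nonneg hs.le (sub_nonneg.2 h1),
      mul_nonneg ht.le (sub_nonneg.2 h2)]
  exact ⟨h x hx fun f hf => (key f hf).1, h y hy fun f hf => (key f hf).2⟩

theorem isWhaleVertex_indVec_add {d : ℕ} {a b : Fin d} (hab : a ≠ b) :
    IsWhaleVertex d (indVec {a} + indVec {a, b}) := by
  classical
  have hne : ({a} : Set (Fin d)) ≠ {a, b} := fun h =>
    hab.symm (h.ge (Or.inr rfl) : b ∈ ({a} : Set (Fin d)))
  have hgne : indVec {a} ≠ indVec {a, b} := indVec_injective.ne hne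
  have hp : indVec {a} + indVec {a, b} ∈ whiteWhale d := by
    rw [← whaleSum_indVec_pair hne]
    exact whaleSum_mem_whiteWhale (Set.pair_subset
      (indVec_mem_whaleGens (Set.singleton_nonempty a))
      (indVec_mem_whaleGens (Set.insert_nonempty a _)))
  have hga : ∀ i, indVec {a} i = if i = a then (1 : ℝ) else 0 := fun i => by
    simp [indVec, Set.indicator_apply]
  have hgb : ∀ i, indVec {a, b} i = if i = a ∨ i = b then (1 : ℝ) else 0 := fun i => by
    simp [indVec, Set.indicator_apply]
  let R : Finset (Fin d) := Finset.univ \ {a, b}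
  have hR : ∀ i, i ∈ R ↔ i ≠ a ∧ i ≠ b := fun i => by simp [R]
  let f : ℝ → ℝ → ℝ → (Fin d → ℝ) →ₗ[ℝ] ℝ := fun α β γ =>
    α • LinearMap.proj a + β • LinearMap.proj b - γ • ∑ i ∈ R, LinearMap.proj i
  have hfx : ∀ α β γ x, f α β γ x = α * x a + β * x b - γ * ∑ i ∈ R, x i := fun α β γ x => by
    simp [f, LinearMap.sum_apply]
  have hRa : ∑ i ∈ R, (indVec {a} : Fin d → ℝ) i = 0 := Finset.sum_eq_zero fun i hi => by
    simp [hga, ((hR i).1 hi).1]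
  have hRb : ∑ i ∈ R, (indVec {a, b} : Fin d → ℝ) i = 0 := Finset.sum_eq_zero fun i hi => by
    simp [hgb, (hR i).1 hi]
  have hmax : ∀ α β γ : ℝ, 0 ≤ α → β ≤ 0 → 0 ≤ α + β → α ≤ γ → ∀ y ∈ whiteWhale d,
      f α β γ y ≤ f α β γ (indVec {a} + indVec {a, b}) := by
    intro α β γ hα hβ hαβ hγ y hy
    refine le_add_of_mem_whiteWhale _ hgne ?_ ?_ ?_ hy
    · rw [hfx, hRa]
      simpa [hga, hab.symm] using hα
    · rw [hfx, hRb]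
      simpa [hgb] using hαβ
    · intro g hg hg1 hg2
      rw [hfx]
      have hnn : ∀ i, 0 ≤ g i := nonneg_of_mem_whaleGens hg
      have hbg := mul_nonneg (neg_nonneg.2 hβ) (hnn b)
      by_cases hz : ∀ i ∈ R, g i = 0
      · rw [Finset.sum_eq_zero hz]
        rcases hg.2 a with h1 | h1
        · rw [h1]
          linarith
        · exfalso
          rcases hg.2 b with h2 | h2
          · refine hg1 (funext fun i => ?_)
            rw [hga]
            split_ifs with hia
            · rw [hia, h1]
            · by_cases hib : i = b
              · rw [hib, h2]
              · exact hz i ((hR i).2 ⟨hia, hib⟩)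
          · refine hg2 (funext fun i => ?_)
            rw [hgb]
            split_ifs with hi
            · rcases hi with rfl | rfl <;> assumption
            · exact hz i ((hR i).2 (not_or.1 hi))
      · push Not at hz
        obtain ⟨i, hi, hgi⟩ := hz
        have hsum : 1 ≤ ∑ i ∈ R, g i := by
          rw [← (hg.2 i).resolve_left hgi]
          exact Finset.single_le_sum (fun j _ => hnn j) hi
        have hga1 : g a ≤ 1 := by rcases hg.2 a with h | h <;> simp [h]
        nlinarith [mul_nonneg (hα.trans hγ) (sub_nonneg.2 hsum),
          mul_nonneg hα (sub_nonneg.2 hga1)]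
  refine mem_extremePoints_of_maximizers hp fun x _ hx => ?_
  have hzero : ∀ i, i ≠ a → i ≠ b → x i = 0 := by
    intro i hia hib
    have := hx (-LinearMap.proj i) fun y hy => by
      refine le_add_of_mem_whiteWhale _ hgne ?_ ?_ ?_ hy
      · simp [hga, hia]
      · simp [hgb, hia, hib]
      · intro g hg _ _
        simpa using nonneg_of_mem_whaleGens hg i
    simpa [hga, hgb, hia, hib] using this
  have e1 := hx (f 2 (-1) 2)
    (hmax _ _ _ (by norm_num) (by norm_num) (by norm_num) (by norm_num))
  have e2 := hx (f 1 (-1) 1)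
    (hmax _ _ _ (by norm_num) (by norm_num) (by norm_num) (by norm_num))
  have hRx : ∑ i ∈ R, x i = 0 :=
    Finset.sum_eq_zero fun i hi => hzero i ((hR i).1 hi).1 ((hR i).1 hi).2
  rw [map_add, hfx, hfx, hfx, hRx, hRa, hRb] at e1 e2
  simp only [hga, hgb, hab.symm, if_true, if_false, true_or, or_true] at e1 e2
  ext i
  rw [Pi.add_apply, hga, hgb]
  by_cases hia : i = a
  · subst hia
    simp only [if_true, true_or]
    linarith
  · by_cases hib : i = b
    · subst hib
      simp only [hia, if_true, if_false, or_true]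
      linarith
    · simp [hia, hib, hzero i hia hib]

/-- For d ≥ 2, the only canonical vertex of the White Whale that is the sum of
exactly 2 generators is (0,…,0,1,2), attained with
S = {(0,…,0,1), (0,…,0,1,1)}. -/
theorem whale_layer_two (d : ℕ) (hd : 2 ≤ d) :
    (∀ S : Set (Fin d → ℝ), S ⊆ whaleGens d → S.ncard = 2 →
      IsWhaleVertex d (whaleSum S) → Monotone (whaleSum S) →
      whaleSum S = fun i : Fin d =>
        if (i : ℕ) = d - 1 then 2 else if (i : ℕ) = d - 2 then 1 else 0) ∧
    IsWhaleVertex d (fun i : Fin d =>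
      if (i : ℕ) = d - 1 then 2 else if (i : ℕ) = d - 2 then 1 else 0) ∧
    whaleSum ({fun i : Fin d => if (i : ℕ) = d - 1 then (1 : ℝ) else 0,
               fun i : Fin d => if d - 2 ≤ (i : ℕ) then (1 : ℝ) else 0} :
        Set (Fin d → ℝ)) =
      fun i : Fin d =>
        if (i : ℕ) = d - 1 then 2 else if (i : ℕ) = d - 2 then 1 else 0 := by
  have hval : indVec {(⟨d - 1, by omega⟩ : Fin d)} +
      indVec {(⟨d - 1, by omega⟩ : Fin d), ⟨d - 2, by omega⟩} = fun i : Fin d =>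
        if (i : ℕ) = d - 1 then (2 : ℝ) else if (i : ℕ) = d - 2 then 1 else 0 := by
    ext i
    simp only [indVec, Pi.add_apply, Set.indicator_apply, Set.mem_insert_iff,
      Set.mem_singleton_iff, Fin.ext_iff, Pi.one_apply]
    split_ifs <;> first | (exfalso; omega) | norm_num
  refine ⟨?_, ?_, ?_⟩
  · intro S hS hcard hv hm
    obtain ⟨g, h, hgh, rfl⟩ := Set.ncard_eq_two.1 hcard
    obtain ⟨A, hA, rfl⟩ := exists_indVec_eq (hS (Or.inl rfl))
    obtain ⟨B, hB, rfl⟩ := exists_indVec_eq (hS (Or.inr rfl))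
    have hAB : A ≠ B := fun h => hgh (h ▸ rfl)
    clear hgh hcard hS
    wlog hsub : A ⊆ B generalizing A B
    · rw [Set.pair_comm] at hv hm ⊢
      exact this B hB A hA hv hm hAB.symm ((hv.comparable hB hA).resolve_right hsub)
    obtain ⟨a, b, hab, rfl, rfl⟩ := hv.exists_eq_singleton_pair hA (hsub.ssubset_of_ne hAB)
    rw [whaleSum_indVec_pair hAB] at hm ⊢
    exact eq_of_monotone_indVec_add hab hm
  · rw [← hval]
    refine isWhaleVertex_indVec_add fun h => ?_
    have := congrArg Fin.val h
    simp only at this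
    omega
  · rw [whaleSum_pair]
    · ext i
      simp only [Pi.add_apply]
      split_ifs <;> first | (exfalso; omega) | norm_num
    · intro h
      have := congrFun h ⟨d - 2, by omega⟩
      simp only [le_refl, if_true] at this
      rw [if_neg (by omega)] at this
      norm_num at this
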